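/- Let M be a unital C*-algebra, E a faithful conditional expectation on M whose range N = E(M) is finite-dimensional over ℂ, and K ≥ 1 a real number such that K·E − id_M is positive. Then M is finite-dimensional over ℂ and dim_ℂ M ≤ ⌊K⌋² · (dim_ℂ N)², where ⌊K⌋ denotes the integer part of K. -/

import Mathlib

variable {A : Type*} [CStarAlgebra A] [PartialOrder A] [StarOrderedRing A]

/-- A conditional expectation on a unital C*-algebra `A`: a linear, idempotent, unital,
positive, contractive (norm-one, since `E 1 = 1`) map whose range is a C*-subalgebra
`B = E(A)` (closed under multiplication and star) and which is a `B`-bimodule map. -/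
structure IsCondExp (E : A → A) : Prop where
  map_add : ∀ a b : A, E (a + b) = E a + E b
  map_smul : ∀ (c : ℂ) (a : A), E (c • a) = c • E a
  idem : ∀ a : A, E (E a) = E a
  map_one : E 1 = 1
  pos : ∀ a : A, 0 ≤ a → 0 ≤ E a
  contractive : ∀ a : A, ‖E a‖ ≤ ‖a‖
  range_mul : ∀ a b : A, E (E a * E b) = E a * E b
  range_star : ∀ a : A, E (star (E a)) = star (E a)
  bimod : ∀ a b c : A, E (E b * a * E c) = E b * E a * E c

section Corner

variable {B : Type*} [CStarAlgebra B]

/-- A finite set of pairwise orthogonal nonzero self-adjoint elements of the corner `pBp`. -/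
structure IsOrthogonalIn (p : B) (s : Finset B) : Prop where
  selfAdjoint : ∀ x ∈ s, IsSelfAdjoint x
  ne_zero : ∀ x ∈ s, x ≠ 0
  mul_left : ∀ x ∈ s, p * x = x
  mul_right : ∀ x ∈ s, x * p = x
  pairwise : ∀ x ∈ s, ∀ y ∈ s, x ≠ y → x * y = 0

/-- A projection `q` whose corner `qBq` consists of scalar multiples of `q`. -/
structure IsMinimalProjection (q : B) : Prop where
  isStarProjection : IsStarProjection q
  scalar : ∀ x, ∃ c : ℂ, q * x * q = c • q

theorem IsSelfAdjoint.mul_self_ne_zero {x : B} (hx : IsSelfAdjoint x) (h0 : x ≠ 0) :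
    x * x ≠ 0 := by
  intro h
  apply h0
  rw [← CStarRing.star_mul_self_eq_zero_iff, hx.star_eq, h]

/-- A continuous function of `x` that is nonzero at `t` and vanishes unless `t` is the strictly
nearest point of `T` to `x`. -/
noncomputable def bump (T : Finset ℝ) (t x : ℝ) : ℝ := ∏ u ∈ T.erase t, max 0 (|x - u| - |x - t|)

theorem continuous_bump (T : Finset ℝ) (t : ℝ) : Continuous (bump T t) := by
  unfold bump
  fun_prop

theorem bump_self_ne_zero (T : Finset ℝ) (t : ℝ) : bump T t t ≠ 0 := by
  unfold bump
  refine Finset.prod_ne_zero_iff.2 fun u hu => ?_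
  have : 0 < |t - u| := abs_pos.2 (sub_ne_zero.2 (Finset.ne_of_mem_erase hu).symm)
  simp only [sub_self, abs_zero, sub_zero]
  exact (lt_max_of_lt_right this).ne'

theorem bump_mul_bump {T : Finset ℝ} {t u : ℝ} (ht : t ∈ T) (hu : u ∈ T) (htu : t ≠ u) (x : ℝ) :
    bump T t x * bump T u x = 0 := by
  unfold bump
  rcases le_total |x - u| |x - t| with h | h
  · rw [Finset.prod_eq_zero (i := u) (Finset.mem_erase.2 ⟨htu.symm, hu⟩), zero_mul]
    exact max_eq_left (by linarith)
  · rw [mul_comm, Finset.prod_eq_zero (i := t) (Finset.mem_erase.2 ⟨htu, ht⟩), zero_mul]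
    exact max_eq_left (by linarith)

theorem cfc_id_mul_eq {a : B} (ha : IsSelfAdjoint a) {g : ℝ → ℝ}
    (hg : ContinuousOn g (spectrum ℝ a)) :
    cfc (fun x => x * g x) a = a * cfc g a := by
  rw [cfc_mul (fun x => x) g a, cfc_id' ℝ a]

theorem cfc_mul_id_eq {a : B} (ha : IsSelfAdjoint a) {g : ℝ → ℝ}
    (hg : ContinuousOn g (spectrum ℝ a)) :
    cfc (fun x => x * g x) a = cfc g a * a := by
  rw [cfc_id_mul_eq ha hg]
  nth_rewrite 1 [← cfc_id' ℝ a]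
  nth_rewrite 4 [← cfc_id' ℝ a]
  exact cfc_commute_cfc _ _ a

/-- If `qBq` contains at most `n` orthogonal elements, self-adjoint elements of `qBq` have finite
spectrum. -/
theorem finite_spectrum_of_card_le {q a : B} {n : ℕ}
    (hn : ∀ s : Finset B, IsOrthogonalIn q s → s.card ≤ n)
    (ha : IsSelfAdjoint a) (hl : q * a = a) (hr : a * q = a) : (spectrum ℝ a).Finite := by
  classical
  suffices h : (spectrum ℝ a \ {0}).Finite from
    (h.union (Set.finite_singleton 0)).subset (by simp)
  by_contra hinf
  obtain ⟨T, hT, hcard⟩ := (Set.not_finite.1 hinf |> Set.Infinite.exists_subset_card_eq) (n + 1)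
  set F : ℝ → B := fun t => cfc (fun x => x * bump T t x) a with hF
  have hcont : ∀ t, ContinuousOn (bump T t) (spectrum ℝ a) :=
    fun t => (continuous_bump T t).continuousOn
  have hsa : ∀ t, IsSelfAdjoint (F t) := fun t => cfc_predicate _ a
  have hne : ∀ t ∈ T, F t ≠ 0 := by
    intro t ht h0
    obtain ⟨hts, ht0⟩ := hT ht
    rw [hF, ← cfc_zero ℝ a] at h0
    have := eqOn_of_cfc_eq_cfc (ha := ha)
      (hf := (continuous_id.mul (continuous_bump T t)).continuousOn)
      (hg := continuousOn_const) h0 hts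
    exact mul_ne_zero ht0 (bump_self_ne_zero T t) this
  have horth : ∀ t ∈ T, ∀ u ∈ T, t ≠ u → F t * F u = 0 := by
    intro t ht u hu htu
    simp only [hF]
    rw [← cfc_mul (fun x => x * bump T t x) (fun x => x * bump T u x) a
      (continuousOn_id.mul (hcont t)) (continuousOn_id.mul (hcont u)), ← cfc_zero ℝ a]
    congr 1
    funext x
    calc x * bump T t x * (x * bump T u x) = x * x * (bump T t x * bump T u x) := by ring
      _ = 0 := by rw [bump_mul_bump ht hu htu, mul_zero]
  have hinj : Set.InjOn F T := by
    intro t ht u hu htu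
    by_contra hne'
    refine (hsa t).mul_self_ne_zero (hne t ht) ?_
    nth_rewrite 2 [htu]
    exact horth t ht u hu hne'
  have := hn (T.image F) ⟨?_, ?_, ?_, ?_, ?_⟩
  · rw [Finset.card_image_of_injOn hinj, hcard] at this
    omega
  · simp only [Finset.forall_mem_image]
    exact fun t _ => hsa t
  · simp only [Finset.forall_mem_image]
    exact hne
  · simp only [Finset.forall_mem_image]
    intro t _
    simp only [hF]
    rw [cfc_id_mul_eq ha (hcont t), ← mul_assoc, hl]
  · simp only [Finset.forall_mem_image]
    intro t _
    simp only [hF]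
    rw [cfc_mul_id_eq ha (hcont t), mul_assoc, hr]
  · simp only [Finset.forall_mem_image]
    intro t ht u hu h
    exact horth t ht u hu fun e => h (e ▸ rfl)

/-- A self-adjoint element of `qBq` with finite spectrum that is not a multiple of `q` splits
`q`. -/
theorem exists_isStarProjection_of_finite_spectrum {q a : B} (ha : IsSelfAdjoint a)
    (hl : q * a = a) (hr : a * q = a) (hfin : (spectrum ℝ a).Finite)
    (hns : ∀ c : ℝ, a ≠ c • q) :
    ∃ e, IsStarProjection e ∧ e ≠ 0 ∧ e ≠ q ∧ q * e = e ∧ e * q = e := by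
  classical
  have : DiscreteTopology (spectrum ℝ a) := hfin.isDiscrete.to_subtype
  have hcont : ∀ f : ℝ → ℝ, ContinuousOn f (spectrum ℝ a) := fun f =>
    continuousOn_iff_continuous_domRestrict.2 continuous_of_discreteTopology
  obtain ⟨t, hts, ht0⟩ : ∃ t ∈ spectrum ℝ a, t ≠ 0 := by
    by_contra! h
    refine hns 0 ?_
    rw [zero_smul, ← cfc_id' ℝ a, ← cfc_zero ℝ a]
    exact cfc_congr h
  set f : ℝ → ℝ := fun x => if x = t then 1 else 0 with hf
  set g : ℝ → ℝ := fun x => t⁻¹ * f x with hg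
  have hfg : f = fun x => x * g x := by
    funext x
    by_cases h : x = t
    · simp [hf, hg, h, ht0]
    · simp [hf, hg, h]
  have hel : cfc f a = a * cfc g a := by
    rw [hfg, cfc_id_mul_eq ha (hcont g)]
  have her : cfc f a = cfc g a * a := by
    rw [hfg, cfc_mul_id_eq ha (hcont g)]
  refine ⟨cfc f a, ⟨?_, cfc_predicate _ a⟩, ?_, ?_, ?_, ?_⟩
  · change cfc f a * cfc f a = cfc f a
    rw [← cfc_mul f f a (hcont f) (hcont f)]
    congr 1
    funext x
    simp [hf]
  · intro h0
    rw [← cfc_zero ℝ a] at h0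
    have := eqOn_of_cfc_eq_cfc (ha := ha) (hf := hcont f) (hg := hcont _) h0 hts
    simp [hf] at this
  · intro h
    refine hns t ?_
    rw [← h, ← cfc_const_mul t f a (hcont f)]
    nth_rewrite 1 [← hr]
    rw [← h]
    rw [← cfc_id_mul_eq ha (hcont f)]
    congr 1
    funext x
    by_cases hx : x = t <;> simp [hf, hx]
  · rw [hel, ← mul_assoc, hl]
  · rw [her, mul_assoc, hr]

theorem exists_isStarProjection_of_not_isMinimalProjection {q : B} {n : ℕ}
    (hn : ∀ s : Finset B, IsOrthogonalIn q s → s.card ≤ n)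
    (hq : IsStarProjection q) (hmin : ¬ IsMinimalProjection q) :
    ∃ e, IsStarProjection e ∧ e ≠ 0 ∧ e ≠ q ∧ q * e = e ∧ e * q = e := by
  have hqq : q * q = q := hq.isIdempotentElem
  by_contra hno
  refine hmin ⟨hq, ?_⟩
  have key : ∀ x : B, IsSelfAdjoint x → ∃ c : ℝ, q * x * q = c • q := by
    intro x hx
    by_contra! hc
    have hsa : IsSelfAdjoint (q * x * q) := by
      simp [isSelfAdjoint_iff, hq.isSelfAdjoint.star_eq, hx.star_eq, mul_assoc]
    have hl : q * (q * x * q) = q * x * q := by rw [← mul_assoc, ← mul_assoc, hqq]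
    have hr : q * x * q * q = q * x * q := by rw [mul_assoc, hqq]
    exact hno (exists_isStarProjection_of_finite_spectrum hsa hl hr
      (finite_spectrum_of_card_le hn hsa hl hr) hc)
  intro x
  obtain ⟨c, hc⟩ := key _ (realPart x).2
  obtain ⟨d, hd⟩ := key _ (imaginaryPart x).2
  refine ⟨c + Complex.I * d, ?_⟩
  conv_lhs => rw [← realPart_add_I_smul_imaginaryPart x]
  rw [mul_add, add_mul, hc, mul_smul_comm, smul_mul_assoc, hd, add_smul, mul_smul]
  simp

/-- If `pBp` contains at most `n` orthogonal elements, the projection `p` is a sum of at most `n`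
minimal projections. -/
theorem exists_sum_isMinimalProjection {p : B} (hp : IsStarProjection p) {n : ℕ}
    (hn : ∀ s : Finset B, IsOrthogonalIn p s → s.card ≤ n) :
    ∃ s : Finset B, s.card ≤ n ∧ (∀ q ∈ s, IsMinimalProjection q ∧ q ≠ 0) ∧ ∑ q ∈ s, q = p := by
  classical
  have hpp : p * p = p := hp.isIdempotentElem
  let P : Finset B → Prop := fun s => IsOrthogonalIn p s ∧ ∀ q ∈ s, IsStarProjection q
  obtain ⟨s, ⟨hs, hproj⟩, hmax⟩ : ∃ s, P s ∧ ∀ t, P t → t.card ≤ s.card := by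
    obtain ⟨s, hs, hsk⟩ := Nat.findGreatest_spec (P := fun k => ∃ s, P s ∧ s.card = k)
      (n := n) (Nat.zero_le n) ⟨∅, ⟨by constructor <;> simp, by simp⟩, rfl⟩
    refine ⟨s, hs, fun t ht => ?_⟩
    rw [hsk]
    exact Nat.le_findGreatest (hn t ht.1) ⟨t, ht, rfl⟩
  have hidem : ∀ q ∈ s, q * q = q := fun q hq => (hproj q hq).isIdempotentElem
  have hextend : ∀ t : Finset B, P t → t.card = s.card → ∀ e, IsStarProjection e → e ≠ 0 →
      p * e = e → e * p = e → (∀ y ∈ t, e * y = 0) → False := by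
    intro t ht hts e he he0 hpe hep hey
    have hye : ∀ y ∈ t, y * e = 0 := fun y hy => by
      have := congrArg star (hey y hy)
      rwa [star_mul, star_zero, he.isSelfAdjoint.star_eq, (ht.2 y hy).isSelfAdjoint.star_eq] at this
    have het : e ∉ t := fun h => he0 (by rw [← he.isIdempotentElem.eq]; exact hey e h)
    have := hmax (insert e t) ⟨⟨?_, ?_, ?_, ?_, ?_⟩, ?_⟩
    · rw [Finset.card_insert_of_notMem het] at this
      omega
    · exact Finset.forall_mem_insert _ _ _ |>.2 ⟨he.isSelfAdjoint, ht.1.selfAdjoint⟩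
    · exact Finset.forall_mem_insert _ _ _ |>.2 ⟨he0, ht.1.ne_zero⟩
    · exact Finset.forall_mem_insert _ _ _ |>.2 ⟨hpe, ht.1.mul_left⟩
    · exact Finset.forall_mem_insert _ _ _ |>.2 ⟨hep, ht.1.mul_right⟩
    · intro x hx y hy hxy
      rcases Finset.mem_insert.1 hx with hxe | hx <;>
        rcases Finset.mem_insert.1 hy with hye' | hy
      · exact absurd (hxe.trans hye'.symm) hxy
      · exact hxe ▸ hey y hy
      · exact hye' ▸ hye x hx
      · exact ht.1.pairwise x hx y hy hxy
    · exact Finset.forall_mem_insert _ _ _ |>.2 ⟨he, ht.2⟩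
  refine ⟨s, hn s hs, fun q hq => ⟨?_, hs.ne_zero q hq⟩, ?_⟩
  · by_contra hmin
    have hcorner : ∀ t : Finset B, IsOrthogonalIn q t → t.card ≤ n := fun t ht =>
      hn t ⟨ht.selfAdjoint, ht.ne_zero,
        fun x hx => by rw [← ht.mul_left x hx, ← mul_assoc, hs.mul_left q hq],
        fun x hx => by rw [← ht.mul_right x hx, mul_assoc, hs.mul_right q hq], ht.pairwise⟩
    obtain ⟨e, he, he0, heq, hqe, heq'⟩ :=
      exists_isStarProjection_of_not_isMinimalProjection hcorner (hproj q hq) hmin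
    have hee : e * e = e := he.isIdempotentElem
    have hqq := hidem q hq
    have heorth : ∀ y ∈ s.erase q, e * y = 0 := fun y hy => by
      obtain ⟨hyq, hy⟩ := Finset.mem_erase.1 hy
      rw [← heq', mul_assoc, hs.pairwise q hq y hy hyq.symm, mul_zero]
    have hyeorth : ∀ y ∈ s.erase q, y * e = 0 := fun y hy => by
      obtain ⟨hyq, hy⟩ := Finset.mem_erase.1 hy
      rw [← hqe, ← mul_assoc, hs.pairwise y hy q hq hyq, zero_mul]
    have hes : e ∉ s.erase q := fun h => he0 (by rw [← hee]; exact heorth e h)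
    have hpe : p * e = e := by rw [← hqe, ← mul_assoc, hs.mul_left q hq]
    have hep : e * p = e := by rw [← heq', mul_assoc, hs.mul_right q hq]
    have hsub : ∀ y ∈ s.erase q, y ∈ s := fun y hy => Finset.mem_of_mem_erase hy
    refine hextend (insert e (s.erase q)) ⟨⟨?_, ?_, ?_, ?_, ?_⟩, ?_⟩ ?_ (q - e) ⟨?_, ?_⟩
      (sub_ne_zero.2 heq.symm) ?_ ?_ ?_
    · exact Finset.forall_mem_insert _ _ _ |>.2
        ⟨he.isSelfAdjoint, fun y hy => hs.selfAdjoint y (hsub y hy)⟩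
    · exact Finset.forall_mem_insert _ _ _ |>.2 ⟨he0, fun y hy => hs.ne_zero y (hsub y hy)⟩
    · exact Finset.forall_mem_insert _ _ _ |>.2 ⟨hpe, fun y hy => hs.mul_left y (hsub y hy)⟩
    · exact Finset.forall_mem_insert _ _ _ |>.2 ⟨hep, fun y hy => hs.mul_right y (hsub y hy)⟩
    · intro x hx y hy hxy
      rcases Finset.mem_insert.1 hx with hxe | hx <;>
        rcases Finset.mem_insert.1 hy with hye' | hy
      · exact absurd (hxe.trans hye'.symm) hxy
      · exact hxe ▸ heorth y hy
      · exact hye' ▸ hyeorth x hx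
      · exact hs.pairwise x (hsub x hx) y (hsub y hy) hxy
    · exact Finset.forall_mem_insert _ _ _ |>.2 ⟨he, fun y hy => hproj y (hsub y hy)⟩
    · rw [Finset.card_insert_of_notMem hes, Finset.card_erase_add_one hq]
    · change (q - e) * (q - e) = q - e
      rw [sub_mul, mul_sub, mul_sub, hqq, hqe, heq', hee, sub_self, sub_zero]
    · exact (hproj q hq).isSelfAdjoint.sub he.isSelfAdjoint
    · rw [mul_sub, hs.mul_left q hq, hpe]
    · rw [sub_mul, hs.mul_right q hq, hep]
    · refine Finset.forall_mem_insert _ _ _ |>.2 ⟨by rw [sub_mul, hqe, hee, sub_self], ?_⟩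
      intro y hy
      rw [sub_mul, heorth y hy, hs.pairwise q hq y (hsub y hy) (Finset.ne_of_mem_erase hy).symm,
        sub_zero]
  · by_contra hne
    have hsq : ∀ y ∈ s, (∑ q ∈ s, q) * y = y := fun y hy => by
      rw [Finset.sum_mul, Finset.sum_eq_single y
        (fun z hz hzy => hs.pairwise z hz y hy hzy) (fun h => absurd hy h), hidem y hy]
    have hpS : p * ∑ q ∈ s, q = ∑ q ∈ s, q := by
      rw [Finset.mul_sum]
      exact Finset.sum_congr rfl hs.mul_left
    have hSp : (∑ q ∈ s, q) * p = ∑ q ∈ s, q := by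
      rw [Finset.sum_mul]
      exact Finset.sum_congr rfl hs.mul_right
    have hSS : (∑ q ∈ s, q) * (∑ q ∈ s, q) = ∑ q ∈ s, q := by
      rw [Finset.mul_sum]
      exact Finset.sum_congr rfl hsq
    refine hextend s ⟨hs, hproj⟩ rfl (p - ∑ q ∈ s, q) ⟨?_, ?_⟩ (sub_ne_zero.2 (Ne.symm hne))
      ?_ ?_ ?_
    · change (p - ∑ q ∈ s, q) * (p - ∑ q ∈ s, q) = p - ∑ q ∈ s, q
      rw [sub_mul, mul_sub, mul_sub, hpp, hpS, hSp, hSS, sub_self, sub_zero]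
    · exact hp.isSelfAdjoint.sub (isSelfAdjoint_sum s hs.selfAdjoint)
    · rw [mul_sub, hpp, hpS]
    · rw [sub_mul, hpp, hSp]
    · intro y hy
      rw [sub_mul, hs.mul_left y hy, hsq y hy, sub_self]

theorem IsMinimalProjection.exists_mul_mul_eq_smul {q r : B} (hq : IsMinimalProjection q)
    (hr : IsMinimalProjection r) : ∃ v : B, ∀ y, ∃ c : ℂ, q * y * r = c • v := by
  by_cases h : ∀ x, q * x * r = 0
  · exact ⟨0, fun y => ⟨0, by simp [h]⟩⟩
  push Not at h
  obtain ⟨x, hx⟩ := h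
  refine ⟨q * x * r, fun y => ?_⟩
  have hqq : q * q = q := hq.isStarProjection.isIdempotentElem
  have hrr : r * r = r := hr.isStarProjection.isIdempotentElem
  have hstar : star (q * x * r) = r * star x * q := by
    simp [hq.isStarProjection.isSelfAdjoint.star_eq, hr.isStarProjection.isSelfAdjoint.star_eq,
      mul_assoc]
  obtain ⟨c, hc⟩ := hq.scalar (x * r * star x)
  obtain ⟨d, hd⟩ := hr.scalar (star x * q * y)
  have hcq : (q * x * r) * star (q * x * r) = c • q := by
    rw [hstar, ← hc]
    calc q * x * r * (r * star x * q) = q * x * (r * r) * star x * q := by simp only [mul_assoc]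
      _ = q * (x * r * star x) * q := by rw [hrr]; simp only [mul_assoc]
  have hc0 : c ≠ 0 := by
    rintro rfl
    rw [zero_smul, CStarRing.mul_star_self_eq_zero_iff] at hcq
    exact hx hcq
  refine ⟨c⁻¹ * d, ?_⟩
  have h1 : c • (q * y * r) = d • (q * x * r) := by
    calc c • (q * y * r) = (c • q) * (q * y * r) := by
          rw [smul_mul_assoc, ← mul_assoc, ← mul_assoc, hqq]
      _ = (q * x * r) * (r * star x * q) * (q * y * r) := by rw [← hcq, hstar]
      _ = q * x * (r * r) * star x * (q * q) * y * r := by simp only [mul_assoc]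
      _ = q * x * (r * (star x * q * y) * r) := by rw [hrr, hqq]; simp only [mul_assoc]
      _ = d • (q * x * r) := by rw [hd, mul_smul_comm]
  rw [mul_smul, ← h1, smul_smul, inv_mul_cancel₀ hc0, one_smul]

theorem finrank_le_of_sum_isMinimalProjection {ι : Type*} [Fintype ι] {q : ι → B}
    (hq : ∀ i, IsMinimalProjection (q i)) (hsum : ∑ i, q i = 1) :
    FiniteDimensional ℂ B ∧ Module.finrank ℂ B ≤ Fintype.card ι ^ 2 := by
  choose v hv using fun ij : ι × ι => (hq ij.1).exists_mul_mul_eq_smul (hq ij.2)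
  have htop : Submodule.span ℂ (Set.range v) = ⊤ := by
    refine eq_top_iff.2 fun x _ => ?_
    have hx : x = ∑ i, ∑ j, q i * x * q j := by
      conv_lhs => rw [← one_mul x, ← mul_one (1 * x), ← hsum]
      simp only [Finset.sum_mul, Finset.mul_sum]
      exact Finset.sum_comm
    rw [hx]
    refine Submodule.sum_mem _ fun i _ => Submodule.sum_mem _ fun j _ => ?_
    obtain ⟨c, hc⟩ := hv (i, j) x
    rw [show q i * x * q j = c • v (i, j) from hc]
    exact Submodule.smul_mem _ _ (Submodule.subset_span ⟨_, rfl⟩)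
  have hfin : FiniteDimensional ℂ B :=
    ⟨htop ▸ Submodule.fg_span (Set.finite_range v)⟩
  refine ⟨hfin, ?_⟩
  have := finrank_range_le_card (R := ℂ) v
  rwa [Set.finrank, htop, finrank_top, Fintype.card_prod, ← sq] at this

theorem IsOrthogonalIn.card_le_finrank [FiniteDimensional ℂ B] {p : B} {s : Finset B}
    (hs : IsOrthogonalIn p s) : s.card ≤ Module.finrank ℂ B := by
  classical
  have hli : LinearIndependent ℂ (fun x : s => (x : B)) := by
    rw [Fintype.linearIndependent_iff]
    intro g hg i
    have h := congrArg (fun z => z * (i : B)) hg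
    simp only [Finset.sum_mul, zero_mul] at h
    rw [Finset.sum_eq_single i] at h
    · rw [smul_mul_assoc] at h
      exact (smul_eq_zero.1 h).resolve_right
        ((hs.selfAdjoint i i.2).mul_self_ne_zero (hs.ne_zero i i.2))
    · intro j _ hji
      rw [smul_mul_assoc, hs.pairwise j j.2 i i.2 (fun h => hji (Subtype.ext h)), smul_zero]
    · simp
  simpa using hli.fintype_card_le_finrank

theorem norm_sum_le_one_of_pairwise_mul_eq_zero {ι : Type*} {s : Finset ι} {y : ι → B}
    (hsa : ∀ i ∈ s, IsSelfAdjoint (y i)) (hnorm : ∀ i ∈ s, ‖y i‖ ≤ 1)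
    (horth : ∀ i ∈ s, ∀ j ∈ s, i ≠ j → y i * y j = 0) : ‖∑ i ∈ s, y i‖ ≤ 1 := by
  have hpow : ∀ k : ℕ, (∑ i ∈ s, y i) ^ (k + 1) = ∑ i ∈ s, y i ^ (k + 1) := by
    intro k
    induction k with
    | zero => simp
    | succ k ih =>
      rw [pow_succ, ih, Finset.sum_mul]
      refine Finset.sum_congr rfl fun i hi => ?_
      rw [Finset.mul_sum, Finset.sum_eq_single i
        (fun j hj hji => by rw [pow_succ, mul_assoc, horth i hi j hj hji.symm, mul_zero])
        (fun h => absurd hi h), ← pow_succ]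
  by_contra! hlt
  obtain ⟨n, hn⟩ := pow_unbounded_of_one_lt (s.card : ℝ) hlt
  have h1 : ‖∑ i ∈ s, y i‖ ^ (2 ^ n) = ‖(∑ i ∈ s, y i) ^ (2 ^ n)‖ :=
    (congrArg NNReal.toReal ((isSelfAdjoint_sum s hsa).nnnorm_pow_two_pow n)).symm
  obtain ⟨k, hk⟩ := Nat.exists_eq_succ_of_ne_zero (pow_ne_zero n (two_ne_zero (α := ℕ)))
  have h2 : ‖(∑ i ∈ s, y i) ^ (2 ^ n)‖ ≤ s.card := by
    rw [hk, Nat.succ_eq_add_one, hpow]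
    refine (norm_sum_le_of_le (f := fun i => y i ^ (k + 1)) s (n := fun _ => 1)
      fun i hi => ?_).trans (by simp)
    exact (norm_pow_le' _ (Nat.succ_pos k)).trans (pow_le_one₀ (norm_nonneg _) (hnorm i hi))
  have h3 := pow_le_pow_right₀ hlt.le (Nat.lt_two_pow_self (n := n)).le
  linarith

end Corner

section CondExp

variable {E : A → A}

/-- The linear map underlying a conditional expectation. -/
def IsCondExp.toLinearMap (hE : IsCondExp E) : A →ₗ[ℂ] A where
  toFun := E
  map_add' := hE.map_add
  map_smul' := hE.map_smul

/-- The range of a conditional expectation, as its set of fixed points. -/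
def IsCondExp.range (hE : IsCondExp E) : StarSubalgebra ℂ A where
  carrier := {a | E a = a}
  mul_mem' {a b} ha hb := by
    have := hE.range_mul a b
    rwa [show E a = a from ha, show E b = b from hb] at this
  add_mem' {a b} ha hb := by
    change E (a + b) = a + b
    rw [hE.map_add, show E a = a from ha, show E b = b from hb]
  algebraMap_mem' c := by
    change E (algebraMap ℂ A c) = algebraMap ℂ A c
    rw [Algebra.algebraMap_eq_smul_one, hE.map_smul, hE.map_one]
  star_mem' {a} ha := by
    change E (star a) = star a
    have := hE.range_star a
    rwa [show E a = a from ha] at this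

set_option linter.unusedSectionVars false in
theorem IsCondExp.span_range (hE : IsCondExp E) :
    Submodule.span ℂ (Set.range E) = Subalgebra.toSubmodule hE.range.toSubalgebra := by
  refine le_antisymm (Submodule.span_le.2 ?_) fun a ha => ?_
  · rintro _ ⟨a, rfl⟩
    exact hE.idem a
  · exact Submodule.subset_span ⟨a, ha⟩

theorem IsCondExp.card_le_floor (hE : IsCondExp E) {K : ℝ} (hK : 1 ≤ K)
    (hpos : ∀ a : A, 0 ≤ a → 0 ≤ K • E a - a) {p : A} (hp : IsStarProjection p) (hp0 : p ≠ 0)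
    (hEp : E p = p) (hmin : ∀ x, E x = x → ∃ c : ℂ, p * x * p = c • p)
    {s : Finset A} (hs : IsOrthogonalIn p s) : s.card ≤ ⌊K⌋₊ := by
  have hpnn : 0 ≤ p := hp.nonneg
  have hpn : ‖p‖ = 1 := by
    have h := CStarRing.norm_star_mul_self (x := p)
    rw [hp.isSelfAdjoint.star_eq, hp.isIdempotentElem.eq] at h
    have := norm_pos_iff.2 hp0
    nlinarith
  set y : A → A := fun x => (‖x‖ ^ 2)⁻¹ • (star x * x) with hy
  have hynn : ∀ x, 0 ≤ y x := fun x =>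
    smul_nonneg (by positivity) (star_mul_self_nonneg x)
  have hynorm : ∀ x ∈ s, ‖y x‖ = 1 := fun x hx => by
    have : ‖x‖ ≠ 0 := norm_ne_zero_iff.2 (hs.ne_zero x hx)
    rw [hy, norm_smul, CStarRing.norm_star_mul_self, norm_inv, norm_pow, norm_norm]
    field_simp
  have hyp : ∀ x ∈ s, p * y x * p = y x := fun x hx => by
    rw [hy]
    simp only [mul_smul_comm, smul_mul_assoc]
    rw [(hs.selfAdjoint x hx).star_eq, ← mul_assoc, hs.mul_left x hx, mul_assoc,
      hs.mul_right x hx]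
  have hyorth : ∀ x ∈ s, ∀ z ∈ s, x ≠ z → y x * y z = 0 := fun x hx z hz hxz => by
    simp only [hy, mul_smul_comm, smul_mul_assoc]
    rw [(hs.selfAdjoint z hz).star_eq, mul_assoc, ← mul_assoc x, hs.pairwise x hx z hz hxz,
      zero_mul, mul_zero, smul_zero, smul_zero]
  have hstate : ∀ x ∈ s, ∃ c : ℝ, 0 ≤ c ∧ E (y x) = c • p ∧ 1 ≤ K * c := by
    intro x hx
    obtain ⟨c, hc⟩ := hmin (E (y x)) (hE.idem _)
    have hEy : E (y x) = c • p := by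
      rw [← hc]
      conv_lhs => rw [← hyp x hx]
      have := hE.bimod (y x) p p
      rwa [hEp] at this
    have hEnn : 0 ≤ E (y x) := hE.pos _ (hynn x)
    have hEc : E (y x) = ‖c‖ • p := by
      have hsqrt : c • p = ((‖c‖ : ℝ) : ℂ) • p := by
        have hconj : star c • p = c • p := by
          have h := (IsSelfAdjoint.of_nonneg hEnn).star_eq
          rwa [hEy, star_smul, hp.isSelfAdjoint.star_eq] at h
        obtain ⟨r, rfl⟩ := Complex.conj_eq_iff_real.1 (smul_left_injective ℂ hp0 hconj)
        rw [hEy, Complex.coe_smul] at hEnn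
        rcases le_or_gt 0 r with hr | hr
        · rw [Complex.norm_real, Real.norm_of_nonneg hr]
        · have h1 : 0 ≤ (-r) • p := smul_nonneg (by linarith) hpnn
          rw [neg_smul, neg_nonneg] at h1
          exact absurd ((smul_eq_zero.1 (le_antisymm h1 hEnn)).resolve_right hp0) hr.ne
      rw [hEy, hsqrt, Complex.coe_smul]
    refine ⟨‖c‖, norm_nonneg c, hEc, ?_⟩
    have hle : y x ≤ K • E (y x) := sub_nonneg.1 (hpos _ (hynn x))
    have := CStarAlgebra.norm_le_norm_of_nonneg_of_le (hynn x) hle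
    rw [hynorm x hx, hEc, norm_smul, norm_smul, hpn, norm_norm, mul_one,
      Real.norm_of_nonneg (by linarith)] at this
    exact this
  choose! c hc0 hcE hcK using hstate
  have hsum : E (∑ x ∈ s, y x) = (∑ x ∈ s, c x) • p := by
    rw [Finset.sum_smul]
    exact (map_sum hE.toLinearMap y s).trans (Finset.sum_congr rfl hcE)
  have hle : ∑ x ∈ s, c x ≤ 1 := by
    have h1 := (hE.contractive (∑ x ∈ s, y x)).trans
      (norm_sum_le_one_of_pairwise_mul_eq_zero
        (fun x _ => IsSelfAdjoint.of_nonneg (hynn x)) (fun x hx => (hynorm x hx).le) hyorth)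
    rw [hsum, norm_smul, hpn, mul_one] at h1
    exact (le_abs_self _).trans h1
  refine Nat.le_floor ?_
  calc (s.card : ℝ) = ∑ x ∈ s, (1 : ℝ) := by simp
    _ ≤ ∑ x ∈ s, K * c x := Finset.sum_le_sum hcK
    _ = K * ∑ x ∈ s, c x := by rw [Finset.mul_sum]
    _ ≤ K * 1 := by gcongr
    _ = K := mul_one K

end CondExp

theorem condexp_findim_range_implies_findim
    (E : A → A) (hE : IsCondExp E)
    (hfaith : ∀ a : A, E (star a * a) = 0 → a = 0)
    (hfin : FiniteDimensional ℂ ↥(Submodule.span ℂ (Set.range E)))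
    (K : ℝ) (hK : 1 ≤ K)
    (hpos : ∀ a : A, 0 ≤ a → 0 ≤ K • E a - a) :
    FiniteDimensional ℂ A ∧
      (Module.finrank ℂ A : ℝ) ≤
        (⌊K⌋ : ℝ) ^ 2 * (Module.finrank ℂ ↥(Submodule.span ℂ (Set.range E)) : ℝ) ^ 2 := by
  classical
  have hfinN : FiniteDimensional ℂ hE.range := by
    rw [hE.span_range] at hfin
    exact hfin
  have hrank : Module.finrank ℂ ↥(Submodule.span ℂ (Set.range E)) =
      Module.finrank ℂ hE.range := by
    rw [hE.span_range]
    rfl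
  have hclosed : IsClosed (hE.range : Set A) := by
    rw [hE.span_range] at hfin
    exact Submodule.closed_of_finiteDimensional (Subalgebra.toSubmodule hE.range.toSubalgebra)
  obtain ⟨s, hscard, hsmin, hssum⟩ :=
    exists_sum_isMinimalProjection (B := hE.range) (p := 1) (.one _)
      (fun t ht => ht.card_le_finrank)
  have hex : ∀ p ∈ s, ∃ t : Finset A, t.card ≤ ⌊K⌋₊ ∧
      (∀ q ∈ t, IsMinimalProjection q ∧ q ≠ 0) ∧ ∑ q ∈ t, q = (p : A) := by
    intro p hp
    obtain ⟨hpm, hp0⟩ := hsmin p hp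
    have hproj : IsStarProjection (p : A) :=
      ⟨congrArg Subtype.val hpm.isStarProjection.isIdempotentElem,
        congrArg Subtype.val hpm.isStarProjection.isSelfAdjoint⟩
    refine exists_sum_isMinimalProjection hproj fun t ht => ?_
    refine hE.card_le_floor hK hpos hproj (fun h => hp0 (Subtype.ext h)) p.2 (fun x hx => ?_) ht
    obtain ⟨c, hc⟩ := hpm.scalar ⟨x, hx⟩
    exact ⟨c, congrArg Subtype.val hc⟩
  choose! t htcard htmin htsum using hex
  obtain ⟨hfd, hdim⟩ := finrank_le_of_sum_isMinimalProjection
    (q := fun i : s.sigma t => i.1.2)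
    (fun i => (htmin _ (Finset.mem_sigma.1 i.2).1 _ (Finset.mem_sigma.1 i.2).2).1)
    (by
      rw [Finset.sum_coe_sort (s.sigma t) (fun i => i.2), Finset.sum_sigma]
      rw [Finset.sum_congr rfl htsum]
      have := congrArg Subtype.val hssum
      simpa using this)
  refine ⟨hfd, ?_⟩
  have hcard : Fintype.card (s.sigma t) ≤ Module.finrank ℂ hE.range * ⌊K⌋₊ := by
    rw [Fintype.card_coe, Finset.card_sigma]
    refine (Finset.sum_le_card_nsmul s _ _ htcard).trans ?_
    rw [smul_eq_mul]
    gcongr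
  have hfloor : (⌊K⌋ : ℝ) = (⌊K⌋₊ : ℝ) :=
    (natCast_floor_eq_intCast_floor (by linarith)).symm
  rw [hrank, hfloor]
  have := hdim.trans (Nat.pow_le_pow_left hcard 2)
  rw [← mul_pow, mul_comm]
  exact_mod_cast this
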